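/- (Norm conservation of the Galerkin step.) Let F : ℝ × ℝ^{m×n} → ℝ^{m×n} be such that trace(F(t,Y)ᵀ Y) = 0 for all t and all Y ∈ ℝ^{m×n} (i.e., F(t,Y) is orthogonal to Y in the Frobenius inner product). Let Ū ∈ ℝ^{m×p} and V̄ ∈ ℝ^{n×p} have orthonormal columns, and let S̄ : [t₀, t₁] → ℝ^{p×p} be differentiable with S̄'(t) = Ūᵀ F(t, Ū S̄(t) V̄ᵀ) V̄. Then ‖S̄(t)‖ = ‖S̄(t₀)‖ for all t ∈ [t₀, t₁]; equivalently, the Frobenius norm of Ū S̄(t) V̄ᵀ is constant in t. -/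

import Mathlib

open Matrix Set

attribute [local instance] Matrix.frobeniusNormedAddCommGroup Matrix.frobeniusNormedSpace

/-- The squared Frobenius norm of a real matrix is `trace (Aᵀ A)`. -/
theorem frobenius_norm_sq_eq_trace {ι κ : Type*} [Fintype ι] [Fintype κ] (A : Matrix ι κ ℝ) :
    ‖A‖ ^ 2 = trace (Aᵀ * A) := by
  have h : 0 ≤ ∑ i, ∑ j, A i j ^ 2 := by positivity
  rw [Matrix.frobenius_norm_def, ← Real.sqrt_eq_rpow]
  simp only [Real.rpow_two, Real.norm_eq_abs, sq_abs]
  rw [Real.sq_sqrt h, Finset.sum_comm]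
  simp [trace, mul_apply, sq]

/-- Multiplying by matrices with orthonormal columns preserves the Frobenius norm. -/
theorem frobenius_norm_mul_mul_transpose {ι κ r s : Type*} [Fintype ι] [Fintype κ] [Fintype r]
    [Fintype s] [DecidableEq r] [DecidableEq s] {U : Matrix ι r ℝ} {V : Matrix κ s ℝ}
    (hU : Uᵀ * U = 1) (hV : Vᵀ * V = 1) (A : Matrix r s ℝ) : ‖U * A * Vᵀ‖ = ‖A‖ := by
  rw [← sq_eq_sq₀ (norm_nonneg _) (norm_nonneg _), frobenius_norm_sq_eq_trace,
    frobenius_norm_sq_eq_trace]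
  calc trace ((U * A * Vᵀ)ᵀ * (U * A * Vᵀ))
      = trace (V * (Aᵀ * (Uᵀ * U) * A * Vᵀ)) := by
        simp only [transpose_mul, transpose_transpose, Matrix.mul_assoc]
    _ = trace (Aᵀ * A) := by
        rw [trace_mul_comm, hU, Matrix.mul_one, Matrix.mul_assoc, hV, Matrix.mul_one]

/-- The derivative of the squared Frobenius norm along a differentiable curve. -/
theorem HasDerivWithinAt.frobenius_norm_sq {ι κ : Type*} [Fintype ι] [Fintype κ]
    {S : ℝ → Matrix ι κ ℝ} {S' : Matrix ι κ ℝ} {s : Set ℝ} {t : ℝ}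
    (hS : HasDerivWithinAt S S' s t) :
    HasDerivWithinAt (fun x => ‖S x‖ ^ 2) (2 * trace (S'ᵀ * S t)) s t := by
  have hentry (i : ι) (j : κ) : HasDerivWithinAt (fun x => S x i j) (S' i j) s t :=
    (LinearMap.toContinuousLinearMap (Matrix.entryLinearMap ℝ ℝ i j)).hasFDerivAt
      |>.comp_hasDerivWithinAt t hS
  have hsum := HasDerivWithinAt.fun_sum (u := Finset.univ) fun j _ =>
    HasDerivWithinAt.fun_sum (u := Finset.univ) fun i _ => (hentry i j).fun_pow 2
  have hnorm : (fun x => ‖S x‖ ^ 2) = fun x => ∑ j, ∑ i, S x i j ^ 2 := by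
    ext x
    rw [frobenius_norm_sq_eq_trace]
    simp [trace, mul_apply, sq]
  rw [hnorm]
  refine hsum.congr_deriv ?_
  simp only [trace, diag_apply, mul_apply, transpose_apply, Finset.mul_sum]
  refine Finset.sum_congr rfl fun j _ => Finset.sum_congr rfl fun i _ => ?_
  push_cast
  ring

/-- Norm conservation of the Galerkin step: if `F(t,Y)` is orthogonal to `Y` in the
Frobenius inner product (`trace(F(t,Y)ᵀ Y) = 0`), then the Galerkin S-step
`S' = Ūᵀ F(t, Ū S V̄ᵀ) V̄` conserves `‖S̄(t)‖`, equivalently the Frobenius norm of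
`Ū S̄(t) V̄ᵀ` is constant in `t`. -/
theorem galerkin_norm_conservation (m n p : ℕ) (t₀ t₁ : ℝ) (ht : t₀ ≤ t₁)
    (F : ℝ → Matrix (Fin m) (Fin n) ℝ → Matrix (Fin m) (Fin n) ℝ)
    (hF : ∀ (t : ℝ) (Y : Matrix (Fin m) (Fin n) ℝ), Matrix.trace ((F t Y)ᵀ * Y) = 0)
    (Ubar : Matrix (Fin m) (Fin p) ℝ) (Vbar : Matrix (Fin n) (Fin p) ℝ)
    (hU : Ubarᵀ * Ubar = 1) (hV : Vbarᵀ * Vbar = 1)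
    (Sbar : ℝ → Matrix (Fin p) (Fin p) ℝ)
    (hSbar : ∀ t ∈ Icc t₀ t₁,
      HasDerivWithinAt Sbar (Ubarᵀ * F t (Ubar * Sbar t * Vbarᵀ) * Vbar) (Icc t₀ t₁) t) :
    ∀ t ∈ Icc t₀ t₁,
      ‖Sbar t‖ = ‖Sbar t₀‖ ∧
      ‖Ubar * Sbar t * Vbarᵀ‖ = ‖Ubar * Sbar t₀ * Vbarᵀ‖ := by
  have hderiv : ∀ t ∈ Icc t₀ t₁,
      HasDerivWithinAt (fun x => ‖Sbar x‖ ^ 2) 0 (Icc t₀ t₁) t := by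
    intro t ht'
    refine (hSbar t ht').frobenius_norm_sq.congr_deriv ?_
    have h : trace ((Ubarᵀ * F t (Ubar * Sbar t * Vbarᵀ) * Vbar)ᵀ * Sbar t) = 0 := by
      rw [← hF t (Ubar * Sbar t * Vbarᵀ)]
      simp only [transpose_mul, transpose_transpose, Matrix.mul_assoc]
      rw [trace_mul_comm]
      simp only [Matrix.mul_assoc]
    rw [h, mul_zero]
  intro t ht'
  have hnorm : ‖Sbar t‖ = ‖Sbar t₀‖ := by
    rw [← sq_eq_sq₀ (norm_nonneg _) (norm_nonneg _)]
    exact constant_of_has_deriv_right_zero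
      (fun x hx => (hderiv x hx).continuousWithinAt)
      (fun x hx => (hderiv x (Ico_subset_Icc_self hx)).mono_of_mem_nhdsWithin
        (Icc_mem_nhdsGE_of_mem hx)) t ht'
  exact ⟨hnorm, by simpa only [frobenius_norm_mul_mul_transpose hU hV] using hnorm⟩
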